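/- Let R > 0 and p > 0, let 𝒢 be a hypergraph, U a set, and π : V(𝒢) → U a function satisfying |π(E)| = |E| for every E ∈ 𝒢, and let ϑ : π(𝒢) → ℝ≥0 be a measure. If Λ_p(ϑ) < e(ϑ)²/R (computed in the hypergraph π(𝒢) on U), then Λ_p(ϑ∘̂π) < e(ϑ∘̂π)²/R (computed in 𝒢). -/

import Mathlib

open scoped Classical

noncomputable section

/-- Total mass `e(ν)` of a measure `ν` on the hypergraph `G`. -/
def eMass {V : Type*} (G : Finset (Finset V)) (ν : Finset V → ℝ) : ℝ := ∑ E ∈ G, ν E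

/-- Degree `d_ν(L)` of a set `L` in the measure `ν`. -/
def dMass {V : Type*} (G : Finset (Finset V)) (ν : Finset V → ℝ) (L : Finset V) : ℝ :=
  ∑ E ∈ G.filter (fun E => L ⊆ E), ν E

/-- `Λ_p(ν) = Σ_{L ⊆ V, |L| ≥ 2} d_ν(L)² p^{−|L|}`. -/
def lamP {V : Type*} [Fintype V] (p : ℝ) (G : Finset (Finset V)) (ν : Finset V → ℝ) : ℝ :=
  ∑ L ∈ (Finset.univ : Finset (Finset V)).filter (fun L => 2 ≤ L.card),
    dMass G ν L ^ 2 / p ^ L.card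

/-- `ν` is a (nonnegative) measure supported on the edges of `G`. -/
def IsMeasureOn {V : Type*} (G : Finset (Finset V)) (ν : Finset V → ℝ) : Prop :=
  (∀ E, 0 ≤ ν E) ∧ ∀ E, E ∉ G → ν E = 0

/-- The induced subhypergraph `G[X]`. -/
def indHG {V : Type*} (G : Finset (Finset V)) (X : Finset V) : Finset (Finset V) :=
  G.filter (fun E => E ⊆ X)

/-- `G` is `(p,R)`-Janson: for `R > 0` there is a measure `ν` on `G` with
`Λ_p(ν) < e(ν)²/R`; for `R = 0` every hypergraph is `(p,R)`-Janson. -/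
def IsJanson {V : Type*} [Fintype V] (p R : ℝ) (G : Finset (Finset V)) : Prop :=
  0 < R → ∃ ν : Finset V → ℝ, IsMeasureOn G ν ∧ lamP p G ν < eMass G ν ^ 2 / R

/-- `I` is an independent set of the hypergraph `G`: no edge of `G` is a subset of `I`. -/
def IndepIn {V : Type*} (G : Finset (Finset V)) (I : Finset V) : Prop := ∀ E ∈ G, ¬ E ⊆ I

/-- The image hypergraph `π(𝒢) = {π(E) : E ∈ 𝒢}`. -/
def pushHG {V U : Type*} [DecidableEq U] (π : V → U) (G : Finset (Finset V)) :
    Finset (Finset U) :=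
  G.image fun E => E.image π

/-- The pullback measure `ϑ∘̂π`, defined by
`(ϑ∘̂π)(E) = ϑ(π(E)) / #{E₀ ∈ 𝒢 : π(E₀) = π(E)}`. -/
def pullback {V U : Type*} [DecidableEq U] (G : Finset (Finset V)) (π : V → U)
    (θ : Finset U → ℝ) : Finset V → ℝ :=
  fun E => θ (E.image π) / ((G.filter fun E₀ => E₀.image π = E.image π).card : ℝ)

theorem sum_pullback_filter {V U : Type*} [DecidableEq U] (G : Finset (Finset V)) (π : V → U)
    (θ : Finset U → ℝ) (P : Finset U → Prop) :
    ∑ E ∈ G with P (E.image π), pullback G π θ E = ∑ F ∈ pushHG π G with P F, θ F := by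
  have hmaps : ∀ E ∈ G.filter (fun E => P (E.image π)),
      E.image π ∈ (pushHG π G).filter P := by
    intro E hE
    rw [Finset.mem_filter] at hE ⊢
    exact ⟨Finset.mem_image_of_mem _ hE.1, hE.2⟩
  rw [← Finset.sum_fiberwise_of_maps_to hmaps]
  refine Finset.sum_congr rfl fun F hF => ?_
  obtain ⟨hFG, hPF⟩ := Finset.mem_filter.1 hF
  obtain ⟨E₁, hE₁, rfl⟩ := Finset.mem_image.1 hFG
  have hfiber : (G.filter (fun E => P (E.image π))).filter
      (fun E => E.image π = E₁.image π) = G.filter (fun E => E.image π = E₁.image π) := by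
    ext E
    simp only [Finset.mem_filter]
    constructor
    · rintro ⟨⟨h₁, -⟩, h₂⟩
      exact ⟨h₁, h₂⟩
    · rintro ⟨h₁, h₂⟩
      exact ⟨⟨h₁, h₂ ▸ hPF⟩, h₂⟩
  rw [hfiber]
  have hconst : ∀ E ∈ G.filter (fun E => E.image π = E₁.image π), pullback G π θ E =
      θ (E₁.image π) / ((G.filter fun E₀ => E₀.image π = E₁.image π).card : ℝ) := by
    intro E hE
    simp only [pullback, (Finset.mem_filter.1 hE).2]
  have hcard : ((G.filter fun E₀ => E₀.image π = E₁.image π).card : ℝ) ≠ 0 :=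
    Nat.cast_ne_zero.2 (Finset.card_ne_zero_of_mem (Finset.mem_filter.2 ⟨hE₁, rfl⟩))
  rw [Finset.sum_congr rfl hconst, Finset.sum_const, nsmul_eq_mul, mul_div_cancel₀ _ hcard]

theorem eMass_pullback {V U : Type*} [DecidableEq U] (G : Finset (Finset V)) (π : V → U)
    (θ : Finset U → ℝ) : eMass G (pullback G π θ) = eMass (pushHG π G) θ := by
  simpa [eMass] using sum_pullback_filter G π θ fun _ => True

theorem pullback_nonneg {V U : Type*} [DecidableEq U] (G : Finset (Finset V)) (π : V → U)
    {θ : Finset U → ℝ} (hθ : ∀ F, 0 ≤ θ F) (E : Finset V) : 0 ≤ pullback G π θ E :=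
  div_nonneg (hθ _) (Nat.cast_nonneg _)

theorem dMass_nonneg {V : Type*} (G : Finset (Finset V)) {ν : Finset V → ℝ}
    (hν : ∀ E, 0 ≤ ν E) (L : Finset V) : 0 ≤ dMass G ν L :=
  Finset.sum_nonneg fun E _ => hν E

/-- A set not mapped injectively by `π` lies in no edge, so it has degree zero. -/
theorem dMass_eq_zero_of_card_image_ne {V U : Type*} [DecidableEq U] {G : Finset (Finset V)}
    {π : V → U} (hπ : ∀ E ∈ G, (E.image π).card = E.card) (ν : Finset V → ℝ) {L : Finset V}
    (hL : (L.image π).card ≠ L.card) : dMass G ν L = 0 := by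
  refine Finset.sum_eq_zero fun E hE => absurd ?_ hL
  obtain ⟨hEG, hLE⟩ := Finset.mem_filter.1 hE
  exact Finset.card_image_of_injOn
    ((Finset.card_image_iff.1 (hπ E hEG)).mono (by exact_mod_cast hLE))

/-- The degrees of the preimages of `M` sum to at most the degree of `M`. -/
theorem sum_dMass_pullback_le {V U : Type*} [DecidableEq U] {G : Finset (Finset V)}
    {π : V → U} (hπ : ∀ E ∈ G, (E.image π).card = E.card) {θ : Finset U → ℝ}
    (hθ : ∀ F, 0 ≤ θ F) (M : Finset U) (S : Finset (Finset V)) (hS : ∀ L ∈ S, L.image π = M) :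
    ∑ L ∈ S, dMass G (pullback G π θ) L ≤ dMass (pushHG π G) θ M := by
  have hM : dMass (pushHG π G) θ M = ∑ E ∈ G with M ⊆ E.image π, pullback G π θ E := by
    rw [dMass]
    convert (sum_pullback_filter G π θ fun F => M ⊆ F).symm
  rw [hM]
  simp only [dMass, Finset.sum_filter]
  rw [Finset.sum_comm]
  refine Finset.sum_le_sum fun E hE => ?_
  have hinj := Finset.card_image_iff.1 (hπ E hE)
  rw [← Finset.sum_filter, Finset.sum_const, nsmul_eq_mul]
  split_ifs with hME
  · refine mul_le_of_le_one_left (pullback_nonneg G π hθ E) ?_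
    rw [Nat.cast_le_one, Finset.card_le_one]
    intro L₁ h₁ L₂ h₂
    rw [Finset.mem_filter] at h₁ h₂
    have himage : π '' (L₁ : Set V) = π '' (L₂ : Set V) := by
      rw [← Finset.coe_image, ← Finset.coe_image, hS _ h₁.1, hS _ h₂.1]
    exact Finset.coe_injective ((hinj.image_eq_image_iff (by exact_mod_cast h₁.2)
      (by exact_mod_cast h₂.2)).1 himage)
  · rw [Finset.card_eq_zero.2, Nat.cast_zero, zero_mul]
    refine Finset.filter_eq_empty_iff.2 fun L hL hLE => hME ?_
    exact hS L hL ▸ Finset.image_subset_image hLE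

theorem lamP_pullback_le {V U : Type*} [Fintype V] [Fintype U] [DecidableEq U] {p : ℝ}
    (hp : 0 < p) {G : Finset (Finset V)} {π : V → U}
    (hπ : ∀ E ∈ G, (E.image π).card = E.card) {θ : Finset U → ℝ} (hθ : ∀ F, 0 ≤ θ F) :
    lamP p G (pullback G π θ) ≤ lamP p (pushHG π G) θ := by
  set d := dMass G (pullback G π θ) with hd
  have hd0 : ∀ L, 0 ≤ d L := dMass_nonneg G (pullback_nonneg G π hθ)
  have hsupp : lamP p G (pullback G π θ) =
      ∑ L ∈ (Finset.univ : Finset (Finset V)).filter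
        (fun L => 2 ≤ L.card ∧ (L.image π).card = L.card), d L ^ 2 / p ^ L.card := by
    symm
    refine Finset.sum_subset (fun L hL => ?_) fun L hL hL' => ?_
    · simp only [Finset.mem_filter, Finset.mem_univ, true_and] at hL ⊢
      exact hL.1
    · simp only [Finset.mem_filter, Finset.mem_univ, true_and] at hL hL'
      rw [hd, dMass_eq_zero_of_card_image_ne hπ _ fun h => hL' ⟨hL, h⟩]
      simp
  rw [hsupp, lamP]
  have hmaps : ∀ L ∈ (Finset.univ : Finset (Finset V)).filter
      (fun L => 2 ≤ L.card ∧ (L.image π).card = L.card),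
      L.image π ∈ (Finset.univ : Finset (Finset U)).filter (fun M => 2 ≤ M.card) := by
    intro L hL
    simp only [Finset.mem_filter, Finset.mem_univ, true_and] at hL ⊢
    exact hL.2 ▸ hL.1
  rw [← Finset.sum_fiberwise_of_maps_to hmaps]
  refine Finset.sum_le_sum fun M _ => ?_
  set S := ((Finset.univ : Finset (Finset V)).filter
    (fun L => 2 ≤ L.card ∧ (L.image π).card = L.card)).filter (fun L => L.image π = M)
  have hS : ∀ L ∈ S, L.image π = M := fun L hL => (Finset.mem_filter.1 hL).2
  have hcard : ∀ L ∈ S, L.card = M.card := fun L hL => by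
    rw [← hS L hL]
    exact (Finset.mem_filter.1 (Finset.mem_filter.1 hL).1).2.2.symm
  calc ∑ L ∈ S, d L ^ 2 / p ^ L.card = (∑ L ∈ S, d L ^ 2) / p ^ M.card := by
        rw [Finset.sum_div]
        exact Finset.sum_congr rfl fun L hL => by rw [hcard L hL]
    _ ≤ (∑ L ∈ S, d L) ^ 2 / p ^ M.card := by
        gcongr
        exact Finset.sum_sq_le_sq_sum_of_nonneg fun L _ => hd0 L
    _ ≤ dMass (pushHG π G) θ M ^ 2 / p ^ M.card := by
        have h0 : 0 ≤ ∑ L ∈ S, d L := Finset.sum_nonneg fun L _ => hd0 L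
        gcongr
        exact sum_dMass_pullback_le hπ hθ M S hS

/-- **Lemma 7.1.**  Suppose `|π(E)| = |E|` for every `E ∈ 𝒢` and `ϑ` is a measure on `π(𝒢)`.
If `Λ_p(ϑ) < e(ϑ)²/R` (computed in `π(𝒢)`), then `Λ_p(ϑ∘̂π) < e(ϑ∘̂π)²/R` (computed in `𝒢`). -/
theorem pullback_preserves_lambda_properties {V U : Type*} [Fintype V] [Fintype U]
    [DecidableEq U] (R p : ℝ) (hR : 0 < R) (hp : 0 < p)
    (G : Finset (Finset V)) (π : V → U)
    (hπ : ∀ E ∈ G, (E.image π).card = E.card)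
    (θ : Finset U → ℝ) (hθ : IsMeasureOn (pushHG π G) θ)
    (h : lamP p (pushHG π G) θ < eMass (pushHG π G) θ ^ 2 / R) :
    lamP p G (pullback G π θ) < eMass G (pullback G π θ) ^ 2 / R := by
  rw [eMass_pullback]
  exact (lamP_pullback_le hp hπ hθ.1).trans_lt h

end
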